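/- arXiv:1302.5796 — 2 statements merged into one kernel-verified Lean document; each statement's English description precedes it below -/
import Mathlib

section
/- Let Y and X be topological spaces, f : Y → Y an injective map, and y₀ ∈ Y a point such that for every y ∈ Y the sequence of iterates f^[m](y) converges to y₀ as m → ∞. Let h : X → X and δ : Y → X be maps satisfying δ ∘ f = h ∘ δ. If there is a neighborhood U of y₀ such that δ is injective on U, then δ is injective on all of Y. -/
/-- If `f : Y → Y` is injective with all forward orbits converging to `y₀`,
`δ : Y → X` semiconjugates `f` to `h` (`δ ∘ f = h ∘ δ`), and `δ` is injective on
some neighborhood of `y₀`, then `δ` is injective on all of `Y`. -/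
theorem injective_of_locally_injective_equivariant
    {Y X : Type*} [TopologicalSpace Y] [TopologicalSpace X]
    (f : Y → Y) (hf : Function.Injective f) (y₀ : Y)
    (hconv : ∀ y : Y, Filter.Tendsto (fun m => f^[m] y) Filter.atTop (nhds y₀))
    (h : X → X) (δ : Y → X) (hcom : δ ∘ f = h ∘ δ)
    (U : Set Y) (hU : U ∈ nhds y₀) (hinj : Set.InjOn δ U) :
    Function.Injective δ := by
  intro a b hab
  obtain ⟨m, ha, hb⟩ := ((hconv a).eventually hU |>.and ((hconv b).eventually hU)).exists
  have hsemi : Function.Semiconj δ f h := congrFun hcom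
  refine hf.iterate m (hinj ha hb ?_)
  rw [(hsemi.iterate_right m).eq, (hsemi.iterate_right m).eq, hab]
end

section
/- Let Y and X be topological spaces, o ∈ X, y₀ ∈ Y, let f : Y → Y be a bijection such that for every y ∈ Y the iterates f^[m](y) converge to y₀ as m → ∞, and let h : X → X be a bijection. Let δ : Y → X be a continuous map with δ ∘ f = h ∘ δ and δ(y₀) = o. If the range of δ contains a neighborhood of o, then the range of δ is exactly the basin of attraction of h toward o, that is, range δ = {x ∈ X | h^[m](x) → o as m → ∞}. -/
/-- Suppose `f : Y → Y` is a bijection all of whose forward orbits converge to `y₀`,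
`h : X → X` is a bijection, and `δ : Y → X` is continuous with `δ ∘ f = h ∘ δ` and
`δ y₀ = o`.  If the range of `δ` contains a neighborhood of `o`, then the range of
`δ` is exactly the basin of attraction of `h` toward `o`. -/
theorem range_of_developing_map_eq_basin
    {Y X : Type*} [TopologicalSpace Y] [TopologicalSpace X]
    (o : X) (y₀ : Y) (f : Y → Y) (hf : Function.Bijective f)
    (hconv : ∀ y : Y, Filter.Tendsto (fun m => f^[m] y) Filter.atTop (nhds y₀))
    (h : X → X) (hh : Function.Bijective h)
    (δ : Y → X) (hδ : Continuous δ) (hcom : δ ∘ f = h ∘ δ) (ho : δ y₀ = o)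
    (V : Set X) (hV : V ∈ nhds o) (hVr : V ⊆ Set.range δ) :
    Set.range δ = {x : X | Filter.Tendsto (fun m => h^[m] x) Filter.atTop (nhds o)} := by
  have hsemi : Function.Semiconj δ f h := fun y => congrFun hcom y
  ext x
  constructor
  · rintro ⟨y, rfl⟩
    have ht := (hδ.tendsto y₀).comp (hconv y)
    rw [ho] at ht
    exact ht.congr fun m => (hsemi.iterate_right m).eq y
  · intro hx
    obtain ⟨m, hm⟩ := (Filter.Tendsto.eventually_mem hx hV).exists
    obtain ⟨y, hy⟩ := hVr hm
    obtain ⟨z, rfl⟩ := (hf.iterate m).surjective y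
    exact ⟨z, (hh.iterate m).injective (((hsemi.iterate_right m).eq z).symm.trans hy)⟩
end
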